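/- Let S be a symmetric block tridiagonal matrix all of whose diagonal blocks are invertible, and let (λ, v) be an eigenpair of Ψl⁻¹ * Pl with λ > 0. Then for each sign ε ∈ {1, −1}, the vector v_e + (ε * Real.sqrt λ) • v_o is nonzero and Φadd⁻¹ * S *ᵥ (v_e + (ε * Real.sqrt λ) • v_o) = (1 − (λ + ε * Real.sqrt λ)/2) • (v_e + (ε * Real.sqrt λ) • v_o); that is, (1 − (λ ± √λ)/2, v_e ± √λ • v_o) are eigenpairs of Φadd⁻¹ * S. -/

import Mathlib

open Matrix

namespace StairPrecond

/-- Real matrices indexed as n×n arrays of m×m blocks. -/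
abbrev Mat (n m : ℕ) := Matrix (Fin n × Fin m) (Fin n × Fin m) ℝ

/-- Vectors compatible with `Mat n m`. -/
abbrev Vec (n m : ℕ) := Fin n × Fin m → ℝ

/-- The (i,j)-block of a block matrix. -/
def blockOf {n m : ℕ} (M : Mat n m) (i j : Fin n) : Matrix (Fin m) (Fin m) ℝ :=
  fun a b => M (i, a) (j, b)

/-- A matrix is block tridiagonal if its (i,j)-block vanishes whenever |i - j| > 1. -/
def IsBlockTridiag {n m : ℕ} (M : Mat n m) : Prop :=
  ∀ i j : Fin n, (i.val + 1 < j.val ∨ j.val + 1 < i.val) → blockOf M i j = 0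

/-- The block-diagonal part `D` of a matrix: keep only the diagonal blocks. -/
def blockDiagPart {n m : ℕ} (M : Mat n m) : Mat n m :=
  fun p q => if p.1 = q.1 then M p q else 0

/-- The left stair Ψl: diagonal blocks everywhere, off-diagonal blocks only in
block rows of odd index (0-indexed). -/
def stairL {n m : ℕ} (M : Mat n m) : Mat n m :=
  fun p q =>
    if p.1 = q.1 ∨ (Odd p.1.val ∧ (p.1.val = q.1.val + 1 ∨ q.1.val = p.1.val + 1)) then M p q
    else 0

/-- The right stair Ψr: diagonal blocks everywhere, off-diagonal blocks only in
block rows of even index (0-indexed). -/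
def stairR {n m : ℕ} (M : Mat n m) : Mat n m :=
  fun p q =>
    if p.1 = q.1 ∨ (Even p.1.val ∧ (p.1.val = q.1.val + 1 ∨ q.1.val = p.1.val + 1)) then M p q
    else 0

/-- Pl = Ψl − S. -/
def Pl {n m : ℕ} (S : Mat n m) : Mat n m := stairL S - S

/-- Pr = Ψr − S. -/
def Pr {n m : ℕ} (S : Mat n m) : Mat n m := stairR S - S

/-- The additive stair preconditioner Φadd⁻¹ = (1/2) • (Ψl⁻¹ + Ψr⁻¹). -/
noncomputable def Phiadd {n m : ℕ} (S : Mat n m) : Mat n m :=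
  (1 / 2 : ℝ) • ((stairL S)⁻¹ + (stairR S)⁻¹)

/-- The symmetric stair preconditioner Φsym⁻¹ = Ψl⁻¹ + Ψr⁻¹ − D⁻¹. -/
noncomputable def Phisym {n m : ℕ} (S : Mat n m) : Mat n m :=
  (stairL S)⁻¹ + (stairR S)⁻¹ - (blockDiagPart S)⁻¹

/-- All diagonal blocks are invertible m×m matrices. -/
def DiagBlocksInvertible {n m : ℕ} (M : Mat n m) : Prop :=
  ∀ i : Fin n, IsUnit (blockOf M i i)

/-- v_e : the part of v supported on blocks of odd index (0-indexed). -/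
def vE {n m : ℕ} (v : Vec n m) : Vec n m := fun p => if Odd p.1.val then v p else 0

/-- v_o : the part of v supported on blocks of even index (0-indexed). -/
def vO {n m : ℕ} (v : Vec n m) : Vec n m := fun p => if Even p.1.val then v p else 0

/-- A stair matrix: block tridiagonal, with off-diagonal blocks nonzero only in
block rows of a fixed parity (a left stair has them only in odd-indexed rows,
a right stair only in even-indexed rows, 0-indexed). -/
def IsStairMatrix {n m : ℕ} (Ψ : Mat n m) : Prop :=
  IsBlockTridiag Ψ ∧
    ((∀ i j : Fin n, i ≠ j → Even i.val → blockOf Ψ i j = 0) ∨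
     (∀ i j : Fin n, i ≠ j → Odd i.val → blockOf Ψ i j = 0))

/-- The diagonal projection onto the blocks of odd index. -/
def oddProj (n m : ℕ) : Mat n m := Matrix.diagonal fun p => if Odd p.1.val then 1 else 0

theorem vE_eq_oddProj_mulVec {n m : ℕ} (v : Vec n m) : vE v = oddProj n m *ᵥ v := by
  ext p
  simp [vE, oddProj, mulVec_diagonal]

theorem vO_eq_sub_vE {n m : ℕ} (v : Vec n m) : vO v = v - vE v := by
  ext p
  by_cases h : Odd p.1.val <;> simp [vE, vO, h, ← Nat.not_odd_iff_even]

/-- The off-diagonal blocks of `stairL S`. -/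
def offDiagL {n m : ℕ} (S : Mat n m) : Mat n m := stairL S - blockDiagPart S

/-- The off-diagonal blocks of `stairR S`. -/
def offDiagR {n m : ℕ} (S : Mat n m) : Mat n m := stairR S - blockDiagPart S

theorem stairL_eq {n m : ℕ} (S : Mat n m) : stairL S = blockDiagPart S + offDiagL S := by
  simp [offDiagL]

theorem stairR_eq {n m : ℕ} (S : Mat n m) : stairR S = blockDiagPart S + offDiagR S := by
  simp [offDiagR]

theorem IsBlockTridiag.eq_add {n m : ℕ} {S : Mat n m} (h : IsBlockTridiag S) :
    S = blockDiagPart S + offDiagL S + offDiagR S := by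
  ext ⟨i, a⟩ ⟨j, b⟩
  have hz : (i.val + 1 < j.val ∨ j.val + 1 < i.val) → S (i, a) (j, b) = 0 := fun hij =>
    congrFun (congrFun (h i j hij) a) b
  simp only [offDiagL, offDiagR, stairL, stairR, blockDiagPart, Matrix.add_apply,
    Matrix.sub_apply, Fin.ext_iff]
  grind

theorem oddProj_mul_blockDiagPart {n m : ℕ} (S : Mat n m) :
    oddProj n m * blockDiagPart S = blockDiagPart S * oddProj n m := by
  ext p q
  simp only [oddProj, diagonal_mul, mul_diagonal, blockDiagPart]
  grind

theorem oddProj_mul_offDiagL {n m : ℕ} (S : Mat n m) :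
    oddProj n m * offDiagL S = offDiagL S := by
  ext p q
  simp only [oddProj, diagonal_mul, offDiagL, stairL, blockDiagPart, Matrix.sub_apply]
  grind

theorem offDiagL_mul_oddProj {n m : ℕ} (S : Mat n m) : offDiagL S * oddProj n m = 0 := by
  ext p q
  simp only [oddProj, mul_diagonal, offDiagL, stairL, blockDiagPart, Matrix.sub_apply,
    Matrix.zero_apply]
  grind

theorem oddProj_mul_offDiagR {n m : ℕ} (S : Mat n m) : oddProj n m * offDiagR S = 0 := by
  ext p q
  simp only [oddProj, diagonal_mul, offDiagR, stairR, blockDiagPart, Matrix.sub_apply,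
    Matrix.zero_apply]
  grind

theorem offDiagR_mul_oddProj {n m : ℕ} (S : Mat n m) :
    offDiagR S * oddProj n m = offDiagR S := by
  ext p q
  simp only [oddProj, mul_diagonal, offDiagR, stairR, blockDiagPart, Matrix.sub_apply]
  grind

/-- If row block `i` of `M *ᵥ u` vanishes and only the diagonal block of that row contributes,
then block `i` of `u` vanishes. -/
theorem block_eq_zero_of_mulVec_eq_zero {n m : ℕ} {M : Mat n m} {u : Vec n m} {i : Fin n}
    (hi : IsUnit (blockOf M i i)) (hu : ∀ a, (M *ᵥ u) (i, a) = 0)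
    (hoff : ∀ j, j ≠ i → ∀ a b, M (i, a) (j, b) * u (j, b) = 0) (b : Fin m) :
    u (i, b) = 0 := by
  have hblock : blockOf M i i *ᵥ (fun b => u (i, b)) = blockOf M i i *ᵥ 0 := by
    ext a
    rw [mulVec_zero, Pi.zero_apply, ← hu a]
    simp only [mulVec, dotProduct, blockOf, Fintype.sum_prod_type]
    exact (Finset.sum_eq_single i (fun j _ hj => Finset.sum_eq_zero fun b _ => hoff j hj a b)
      (by simp)).symm
  exact congrFun (mulVec_injective_iff_isUnit.mpr hi hblock) b

/-- A block matrix with invertible diagonal blocks whose off-diagonal blocks only lead from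
rows in `P` to columns outside `P` is invertible. -/
theorem isUnit_of_offDiag_eq_zero {n m : ℕ} {M : Mat n m} (hdiag : DiagBlocksInvertible M)
    (P : Fin n → Prop) (hM : ∀ i j, j ≠ i → ¬(P i ∧ ¬P j) → blockOf M i j = 0) :
    IsUnit M := by
  have hM' : ∀ i j, j ≠ i → ¬(P i ∧ ¬P j) → ∀ a b, M (i, a) (j, b) = 0 := fun i j hj hP a b =>
    congrFun (congrFun (hM i j hj hP) a) b
  rw [← mulVec_injective_iff_isUnit]
  refine (injective_iff_map_eq_zero M.mulVecLin).mpr fun u hu => ?_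
  have hu' : ∀ i a, (M *ᵥ u) (i, a) = 0 := fun i a => congrFun hu (i, a)
  have hnot : ∀ i, ¬P i → ∀ b, u (i, b) = 0 := fun i hi =>
    block_eq_zero_of_mulVec_eq_zero (hdiag i) (hu' i) fun j hj a b => by
      rw [hM' i j hj (fun h => hi h.1), zero_mul]
  ext ⟨i, b⟩
  refine block_eq_zero_of_mulVec_eq_zero (hdiag i) (hu' i) (fun j hj a b => ?_) b
  by_cases hP : P i ∧ ¬P j
  · rw [hnot j hP.2, mul_zero]
  · rw [hM' i j hj hP, zero_mul]

theorem DiagBlocksInvertible.isUnit_stairL {n m : ℕ} {S : Mat n m}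
    (h : DiagBlocksInvertible S) : IsUnit (stairL S) := by
  refine isUnit_of_offDiag_eq_zero (fun i => ?_) (fun i => Odd i.val) fun i j hj hP => ?_
  · convert h i using 1
    ext a b
    simp [blockOf, stairL]
  · ext a b
    simp only [blockOf, stairL, Matrix.zero_apply]
    grind

theorem DiagBlocksInvertible.isUnit_stairR {n m : ℕ} {S : Mat n m}
    (h : DiagBlocksInvertible S) : IsUnit (stairR S) := by
  refine isUnit_of_offDiag_eq_zero (fun i => ?_) (fun i => Even i.val) fun i j hj hP => ?_
  · convert h i using 1
    ext a b
    simp [blockOf, stairR]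
  · ext a b
    simp only [blockOf, stairR, Matrix.zero_apply]
    grind

theorem vE_add_smul_vO_ne_zero {n m : ℕ} {v : Vec n m} (hv : v ≠ 0) {s : ℝ} (hs : s ≠ 0) :
    vE v + s • vO v ≠ 0 := by
  refine fun h => hv (funext fun p => ?_)
  have hp := congrFun h p
  by_cases hodd : Odd p.1.val
  · simpa [vE, vO, hodd, ← Nat.not_odd_iff_even] using hp
  · simpa [vE, vO, hodd, ← Nat.not_odd_iff_even, hs] using hp

/-- The odd and even block rows of the eigenvalue equation for `Ψl⁻¹ * Pl`. -/
theorem left_eigenpair_equations {n m : ℕ} {S : Mat n m} (htri : IsBlockTridiag S)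
    (hdiag : DiagBlocksInvertible S) {lam : ℝ} {v : Vec n m} (hlam : lam ≠ 0)
    (heig : ((stairL S)⁻¹ * Pl S) *ᵥ v = lam • v) :
    blockDiagPart S *ᵥ vE v = -(offDiagL S *ᵥ vO v) ∧
      offDiagR S *ᵥ vE v = -(lam • blockDiagPart S *ᵥ vO v) := by
  have hdet := (isUnit_iff_isUnit_det _).mp hdiag.isUnit_stairL
  have hPl : Pl S = -offDiagR S := by
    rw [Pl, stairL_eq]
    nth_rewrite 3 [htri.eq_add]
    abel
  have hrow : -(offDiagR S *ᵥ v) =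
      lam • (blockDiagPart S *ᵥ v + offDiagL S *ᵥ v) := by
    have := congrArg (stairL S *ᵥ ·) heig
    simp only [mulVec_mulVec, mul_nonsing_inv_cancel_left _ _ hdet, mulVec_smul] at this
    rwa [hPl, neg_mulVec, stairL_eq, add_mulVec] at this
  have hodd : blockDiagPart S *ᵥ vE v + offDiagL S *ᵥ v = 0 := by
    have := congrArg (oddProj n m *ᵥ ·) hrow
    simp only [mulVec_neg, mulVec_smul, mulVec_add, mulVec_mulVec, oddProj_mul_offDiagR,
      oddProj_mul_blockDiagPart, oddProj_mul_offDiagL, zero_mulVec, neg_zero] at this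
    rw [vE_eq_oddProj_mulVec, mulVec_mulVec]
    exact (smul_eq_zero.mp this.symm).resolve_left hlam
  have hL : offDiagL S *ᵥ vE v = 0 := by
    rw [vE_eq_oddProj_mulVec, mulVec_mulVec, offDiagL_mul_oddProj, zero_mulVec]
  have hR : offDiagR S *ᵥ vE v = offDiagR S *ᵥ v := by
    rw [vE_eq_oddProj_mulVec, mulVec_mulVec, offDiagR_mul_oddProj]
  rw [vO_eq_sub_vE, mulVec_sub, mulVec_sub, hL, hR, sub_zero]
  refine ⟨eq_neg_of_add_eq_zero_left hodd, ?_⟩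
  rw [← neg_eq_iff_eq_neg, hrow, eq_neg_of_add_eq_zero_right hodd, sub_eq_add_neg]

/-- If (λ, v) is an eigenpair of Ψl⁻¹ * Pl with λ > 0, then for each sign ε ∈ {1, -1},
(1 − (λ + ε√λ)/2, v_e + ε√λ • v_o) is an eigenpair of Φadd⁻¹ * S. -/
theorem add_eigenpairs_of_left_eigenpair {n m : ℕ} (hn : 0 < n) (hm : 0 < m)
    (S : Mat n m) (hsymm : S.IsSymm) (htri : IsBlockTridiag S)
    (hdiag : DiagBlocksInvertible S)
    (lam : ℝ) (v : Vec n m) (hv : v ≠ 0)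
    (heig : ((stairL S)⁻¹ * Pl S) *ᵥ v = lam • v) (hlam : 0 < lam)
    (eps : ℝ) (heps : eps = 1 ∨ eps = -1) :
    vE v + (eps * Real.sqrt lam) • vO v ≠ 0 ∧
      (Phiadd S * S) *ᵥ (vE v + (eps * Real.sqrt lam) • vO v) =
        (1 - (lam + eps * Real.sqrt lam) / 2) • (vE v + (eps * Real.sqrt lam) • vO v) := by
  set s := eps * Real.sqrt lam with hs
  have hsq : s * s = lam := by
    have := Real.mul_self_sqrt hlam.le
    rcases heps with rfl | rfl <;> simpa [hs] using this
  have hs0 : s ≠ 0 := fun h => hlam.ne' (by rw [← hsq, h, zero_mul])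
  refine ⟨vE_add_smul_vO_ne_zero hv hs0, ?_⟩
  obtain ⟨hD, hF⟩ := left_eigenpair_equations htri hdiag hlam.ne' heig
  have hEx : offDiagL S *ᵥ vE v = 0 := by
    rw [vE_eq_oddProj_mulVec, mulVec_mulVec, offDiagL_mul_oddProj, zero_mulVec]
  have hFy : offDiagR S *ᵥ vO v = 0 := by
    rw [vO_eq_sub_vE, vE_eq_oddProj_mulVec, mulVec_sub, mulVec_mulVec, offDiagR_mul_oddProj,
      sub_self]
  have hS : S *ᵥ (vE v + s • vO v) =
      (blockDiagPart S + offDiagL S + offDiagR S) *ᵥ (vE v + s • vO v) := by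
    rw [← htri.eq_add]
  have hL : S *ᵥ (vE v + s • vO v) =
      stairL S *ᵥ ((vE v + s • vO v) - lam • (vE v + vO v)) := by
    rw [hS, stairL_eq]
    simp only [add_mulVec, mulVec_add, mulVec_sub, mulVec_smul, hD, hF, hEx, hFy]
    module
  have hR : S *ᵥ (vE v + s • vO v) =
      stairR S *ᵥ ((vE v + s • vO v) - s • (vE v + lam • vO v)) := by
    rw [hS, stairR_eq]
    simp only [add_mulVec, mulVec_add, mulVec_sub, mulVec_smul, hD, hF, hEx, hFy]
    module
  have hLinv : (stairL S)⁻¹ *ᵥ (S *ᵥ (vE v + s • vO v)) =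
      (vE v + s • vO v) - lam • (vE v + vO v) := by
    rw [hL, mulVec_mulVec,
      nonsing_inv_mul _ ((isUnit_iff_isUnit_det _).mp hdiag.isUnit_stairL), one_mulVec]
  have hRinv : (stairR S)⁻¹ *ᵥ (S *ᵥ (vE v + s • vO v)) =
      (vE v + s • vO v) - s • (vE v + lam • vO v) := by
    rw [hR, mulVec_mulVec,
      nonsing_inv_mul _ ((isUnit_iff_isUnit_det _).mp hdiag.isUnit_stairR), one_mulVec]
  rw [← mulVec_mulVec, Phiadd, smul_mulVec, add_mulVec, hLinv, hRinv, ← hsq]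
  module

end StairPrecond
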